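/- Let q = p^e be a power of a prime with q ≡ 1 (mod 6), t = (q-1)/6, ω₆ = ω^t, ω₃ = ω^{2t}, ω₂ = ω^{3t}, and let λ ∈ 𝔽_q with λ ≠ 0 and λ⁶ ≠ 1. For the equivalence class of w = (0,0,0,0,3,3): Σ_{w'∈[0,0,0,0,3,3]} N_q(0,w') + S_{[0,0,0,0,3,3]} = −q³·ω₆(-1)·J(ω₂,ω̄₃,ω̄₆)·₄F₃(ω₆,ω̄₆,ω̄₃,ω₃; ε,ε,ω₂ | 1/λ⁶)_q. -/

import Mathlib

open scoped Classical

noncomputable section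

/-- The Gauss sum `g(χ) = ∑ₓ χ(x) exp(2π√-1 · tr(x)/p)` of a multiplicative character `χ`
of a finite field `F` of characteristic `p`, where `tr : F → 𝔽_p` is the trace map. -/
def gaussChar (p : ℕ) (F : Type) [Field F] [Fintype F] [Algebra (ZMod p) F]
    (χ : MulChar F ℂ) : ℂ :=
  ∑ x : F, χ x *
    Complex.exp (2 * Real.pi * Complex.I * ((Algebra.trace (ZMod p) F x).val : ℂ) / (p : ℂ))

/-- The Jacobi sum `J(χ₁, …, χₙ) = ∑_{x₁ + ⋯ + xₙ = 1} χ₁(x₁) ⋯ χₙ(xₙ)`. -/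
def jacobiS (F : Type) [Field F] [Fintype F] {n : ℕ} (χ : Fin n → MulChar F ℂ) : ℂ :=
  ∑ v ∈ Finset.univ.filter (fun v : Fin n → F => ∑ i, v i = 1), ∏ i, χ i (v i)

/-- The normalized Jacobi sum `binom(A; B) = (B(-1)/q) · J(A, B̄)`. -/
def gBinom (F : Type) [Field F] [Fintype F] (A B : MulChar F ℂ) : ℂ :=
  B (-1) / (Fintype.card F : ℂ) * jacobiS F ![A, B⁻¹]

/-- Greene's finite-field hypergeometric function `ₙ₊₁Fₙ` (case `n ≥ 2`), where the sum over all
multiplicative characters is written as a sum over the powers `ω^j`, `0 ≤ j ≤ q - 2`, of a fixed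
generator `ω` of the character group. -/
def greeneF (F : Type) [Field F] [Fintype F] (ω : MulChar F ℂ) {n : ℕ}
    (A : Fin (n + 1) → MulChar F ℂ) (B : Fin n → MulChar F ℂ) (x : F) : ℂ :=
  (Fintype.card F : ℂ) / ((Fintype.card F : ℂ) - 1) *
    ∑ j ∈ Finset.range (Fintype.card F - 1),
      gBinom F (A 0 * ω ^ j) (ω ^ j) *
        (∏ i : Fin n, gBinom F (A i.succ * ω ^ j) (B i * ω ^ j)) * (ω ^ j) x

/-- Greene's finite-field hypergeometric function `₂F₁` (case `n = 1`):
`₂F₁(A₀, A₁; B₁ | x) = ε(x) · (A₁B₁(-1)/q) · ∑_y A₁(y) (A̅₁B₁)(1-y) A̅₀(1-xy)`. -/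
def greene2F1 (F : Type) [Field F] [Fintype F] (A₀ A₁ B₁ : MulChar F ℂ) (x : F) : ℂ :=
  (1 : MulChar F ℂ) x * ((A₁ * B₁) (-1) / (Fintype.card F : ℂ)) *
    ∑ y : F, A₁ y * (A₁⁻¹ * B₁) (1 - y) * A₀⁻¹ (1 - x * y)

/-- The number of `F`-rational points of the Dwork hypersurface
`x₁^d + ⋯ + x_d^d = dλ x₁ ⋯ x_d` in projective space. -/
def dworkCount (F : Type) [Field F] [Fintype F] (d : ℕ) (lam : F) : ℕ :=
  Nat.card {P : Projectivization F (Fin d → F) //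
    ∑ i, P.rep i ^ d = (d : F) * lam * ∏ i, P.rep i}

/-- The number of `F`-rational points of the diagonal hypersurface
`x₁^d + ⋯ + xₙ^d = dλ x₁^{h₁} ⋯ xₙ^{hₙ}` in projective space. -/
def diagCount (F : Type) [Field F] [Fintype F] (d n : ℕ) (h : Fin n → ℕ) (lam : F) : ℕ :=
  Nat.card {P : Projectivization F (Fin n → F) //
    ∑ i, P.rep i ^ d = (d : F) * lam * ∏ i, P.rep i ^ h i}

/-- The quantity `N_q(0, w)` from Koblitz's formula, with `t = (q - 1)/d`. -/
def NqW (p : ℕ) (F : Type) [Field F] [Fintype F] [Algebra (ZMod p) F]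
    (ω : MulChar F ℂ) (d : ℕ) {n : ℕ} (w : Fin n → ZMod d) : ℂ :=
  if ∀ i, w i = 0 then ((Fintype.card F : ℂ) ^ (n - 1) - 1) / ((Fintype.card F : ℂ) - 1)
  else if ∀ i, w i ≠ 0 then
    (1 / (Fintype.card F : ℂ)) *
      ∏ i, gaussChar p F (ω ^ ((w i).val * ((Fintype.card F - 1) / d)))
  else 0

/-- The quantity `S_{[w]} = (q-1)⁻¹ ∑_{j=0}^{q-2} (∏ᵢ g(ω^{wᵢt + hᵢj}) / g(ω^{dj})) ω^{dj}(dλ)`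
from Koblitz's formula, with `t = (q - 1)/d`. -/
def SW (p : ℕ) (F : Type) [Field F] [Fintype F] [Algebra (ZMod p) F]
    (ω : MulChar F ℂ) (d : ℕ) {n : ℕ} (h : Fin n → ℕ) (w : Fin n → ZMod d) (lam : F) : ℂ :=
  ((Fintype.card F : ℂ) - 1)⁻¹ *
    ∑ j ∈ Finset.range (Fintype.card F - 1),
      (∏ i, gaussChar p F (ω ^ ((w i).val * ((Fintype.card F - 1) / d) + h i * j))) /
          gaussChar p F (ω ^ (d * j)) * (ω ^ (d * j)) ((d : F) * lam)

end


section HD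
variable {F : Type} [Field F] [Fintype F]

/-- the fibre sums -/
noncomputable def fibK {n : ℕ} (χ : Fin n → MulChar F ℂ) (s : F) : ℂ :=
  ∑ v ∈ Finset.univ.filter (fun v : Fin n → F => ∑ i, v i = s), ∏ i, χ i (v i)

lemma fibK_one {n : ℕ} (χ : Fin n → MulChar F ℂ) : fibK χ 1 = jacobiS F χ := rfl

lemma prod_mulChar_apply {n : ℕ} (χ : Fin n → MulChar F ℂ) (a : Fˣ) :
    (∏ i, χ i) (a : F) = ∏ i, χ i a := by
  have h : ∀ s : Finset (Fin n), (∏ i ∈ s, χ i) (a : F) = ∏ i ∈ s, χ i a := by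
    intro s
    induction s using Finset.induction_on with
    | empty => simp
    | insert i s hi ih => rw [Finset.prod_insert hi, Finset.prod_insert hi, MulChar.mul_apply, ih]
  exact h _

lemma fibK_scale {n : ℕ} (χ : Fin n → MulChar F ℂ) (a : Fˣ) (s : F) :
    fibK χ (a * s) = (∏ i, χ i) (a : F) * fibK χ s := by
  unfold fibK
  rw [Finset.mul_sum]
  symm
  apply Finset.sum_bij' (fun v _ => fun i => (a : F) * v i) (fun v _ => fun i => ((a⁻¹ : Fˣ) : F) * v i)
  · intro v hv
    simp only [Finset.mem_filter, Finset.mem_univ, true_and] at hv ⊢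
    rw [← Finset.mul_sum, hv]
  · intro v hv
    simp only [Finset.mem_filter, Finset.mem_univ, true_and] at hv ⊢
    rw [← Finset.mul_sum, hv]
    simp
  · intro v hv
    ext i; simp
  · intro v hv
    ext i; simp
  · intro v hv
    rw [prod_mulChar_apply, ← Finset.prod_mul_distrib]
    simp

lemma sum_fibK {n : ℕ} (χ : Fin n → MulChar F ℂ) (ψ : F → ℂ) :
    ∑ s, ψ s * fibK χ s = ∑ v : Fin n → F, ψ (∑ i, v i) * ∏ i, χ i (v i) := by
  rw [← Finset.sum_fiberwise (g := fun v : Fin n → F => ∑ i, v i)]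
  apply Finset.sum_congr rfl
  intro s _
  unfold fibK
  rw [Finset.mul_sum]
  apply Finset.sum_congr rfl
  intro v hv
  simp only [Finset.mem_filter, Finset.mem_univ, true_and] at hv
  rw [hv]

lemma addChar_sum {n : ℕ} (ψ : AddChar F ℂ) (v : Fin n → F) :
    ψ (∑ i, v i) = ∏ i, ψ (v i) := by
  have h : ∀ s : Finset (Fin n), ψ (∑ i ∈ s, v i) = ∏ i ∈ s, ψ (v i) := by
    intro s
    induction s using Finset.induction_on with
    | empty => simp
    | insert i s hi ih => rw [Finset.prod_insert hi, Finset.sum_insert hi, AddChar.map_add_eq_mul, ih]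
  exact h _

lemma prod_gauss {n : ℕ} (χ : Fin n → MulChar F ℂ) (ψ : AddChar F ℂ) :
    ∏ i, gaussSum (χ i) ψ = ∑ s, ψ s * fibK χ s := by
  rw [sum_fibK]
  unfold gaussSum
  rw [Finset.prod_univ_sum, Fintype.piFinset_univ]
  apply Finset.sum_congr rfl
  intro v _
  rw [addChar_sum, Finset.prod_mul_distrib, mul_comm]

lemma fibK_ne_zero {n : ℕ} (χ : Fin n → MulChar F ℂ) {s : F} (hs : s ≠ 0) :
    fibK χ s = (∏ i, χ i) s * jacobiS F χ := by
  have := fibK_scale χ (Units.mk0 s hs) 1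
  simpa [fibK_one] using this

lemma sum_split {n : ℕ} (χ : Fin n → MulChar F ℂ) (ψ : F → ℂ) :
    ∑ s, ψ s * fibK χ s = ψ 0 * fibK χ 0 + (∑ s, (∏ i, χ i) s * ψ s) * jacobiS F χ := by
  rw [← Finset.add_sum_erase _ _ (Finset.mem_univ (0 : F)),
    ← Finset.add_sum_erase _ (fun s => (∏ i, χ i) s * ψ s) (Finset.mem_univ (0 : F))]
  simp only [MulChar.map_zero, zero_mul, zero_add]
  congr 1
  rw [Finset.sum_mul]
  apply Finset.sum_congr rfl
  intro s hs
  rw [fibK_ne_zero χ (Finset.ne_of_mem_erase hs)]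
  ring

lemma prod_gauss_of_ne {n : ℕ} (χ : Fin n → MulChar F ℂ) (ψ : AddChar F ℂ)
    (h : ∏ i, χ i ≠ 1) :
    ∏ i, gaussSum (χ i) ψ = gaussSum (∏ i, χ i) ψ * jacobiS F χ := by
  have h0 : fibK χ 0 = 0 := by
    obtain ⟨a, ha⟩ := MulChar.ne_one_iff.mp h
    have := fibK_scale χ a 0
    rw [mul_zero] at this
    have h2 : ((∏ i, χ i) (a : F) - 1) * fibK χ 0 = 0 := by linear_combination -this
    rcases mul_eq_zero.mp h2 with h3 | h3
    · exact absurd (sub_eq_zero.mp h3) ha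
    · exact h3
  rw [prod_gauss, sum_split, h0]
  simp [gaussSum]

lemma prod_gauss_of_eq {n : ℕ} (χ : Fin n → MulChar F ℂ) (ψ : AddChar F ℂ) (hψ : ψ ≠ 1)
    (h : ∏ i, χ i = 1) (i0 : Fin n) (hi : χ i0 ≠ 1) :
    ∏ i, gaussSum (χ i) ψ = - (Fintype.card F : ℂ) * jacobiS F χ := by
  have h1 := sum_split χ (1 : AddChar F ℂ)
  rw [← prod_gauss, Finset.prod_eq_zero (Finset.mem_univ i0) (gaussSum_one_right hi)] at h1
  have h2 : ∑ s, (∏ i, χ i) s * (1 : AddChar F ℂ) s = (Fintype.card F : ℂ) - 1 := by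
    rw [h]
    have := gaussSum_one_one (R := F) (R' := ℂ)
    unfold gaussSum at this
    rw [this, Nat.card_eq_fintype_card, Fintype.card_units, Nat.cast_sub Fintype.card_pos]
    simp
  rw [h2] at h1
  rw [prod_gauss, sum_split]
  have h3 := gaussSum_one_left (R := F) (R' := ℂ) hψ
  unfold gaussSum at h3
  rw [h, h3]
  simp only [AddChar.map_zero_eq_one, AddChar.one_apply] at h1 ⊢
  linear_combination -h1

end HD

section HD2
variable {F : Type} [Field F] [Fintype F]

lemma mc_neg_one_inv (χ : MulChar F ℂ) : χ⁻¹ (-1) = χ (-1) := by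
  rw [MulChar.inv_apply']; congr 1; norm_num

lemma mc_neg_one_sq (χ : MulChar F ℂ) : χ (-1) * χ (-1) = 1 := by
  rw [← map_mul]; simp

lemma g_inv {ψ : AddChar F ℂ} (hψ : ψ.IsPrimitive) {χ : MulChar F ℂ} (hχ : χ ≠ 1) :
    gaussSum χ ψ * gaussSum χ⁻¹ ψ = χ (-1) * (Fintype.card F : ℂ) := by
  rw [← gaussSum_mul_gaussSum_eq_card hχ hψ, ← mul_gaussSum_inv_eq_gaussSum χ⁻¹ ψ, mc_neg_one_inv]
  ring

lemma prim_ne_one {ψ : AddChar F ℂ} (hψ : ψ.IsPrimitive) : ψ ≠ 1 := by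
  have := hψ one_ne_zero
  simpa using this

lemma g_one {ψ : AddChar F ℂ} (hψ : ψ.IsPrimitive) : gaussSum (1 : MulChar F ℂ) ψ = -1 :=
  gaussSum_one_left (prim_ne_one hψ)

lemma cardC_ne_zero : (Fintype.card F : ℂ) ≠ 0 := by
  exact_mod_cast Fintype.card_ne_zero

lemma g_ne {ψ : AddChar F ℂ} (hψ : ψ.IsPrimitive) (χ : MulChar F ℂ) : gaussSum χ ψ ≠ 0 := by
  by_cases h : χ = 1
  · rw [h, g_one hψ]; norm_num
  · intro h0
    have := gaussSum_mul_gaussSum_eq_card h hψ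
    rw [h0, zero_mul] at this
    exact cardC_ne_zero this.symm

lemma g_norm {ψ : AddChar F ℂ} (hψ : ψ.IsPrimitive) {χ : MulChar F ℂ} (hχ : χ ≠ 1) :
    ‖gaussSum χ ψ‖ = Real.sqrt (Fintype.card F) := by
  have h := gaussSum_mul_gaussSum_eq_card hχ hψ
  rw [← star_gaussSum_eq] at h
  have h2 := congrArg norm h
  rw [norm_mul, norm_star, Complex.norm_natCast] at h2
  rw [← h2, Real.sqrt_mul_self (norm_nonneg _)]

lemma mc_norm (χ : MulChar F ℂ) {a : F} (ha : a ≠ 0) : ‖χ a‖ = 1 := by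
  have h : (χ a) ^ (Fintype.card F - 1) = 1 := by
    rw [← map_pow, FiniteField.pow_card_sub_one_eq_one a ha, map_one]
  exact Complex.norm_eq_one_of_pow_eq_one h (by have := Fintype.one_lt_card (α := F); omega)

/-- orthogonality -/
lemma orth (ω : MulChar F ℂ) (hω : ∀ χ : MulChar F ℂ, ∃ j : ℕ, χ = ω ^ j) (a : F) (ha : a ≠ 0) :
    ∑ j ∈ Finset.range (Fintype.card F - 1), (ω ^ j) a =
      if a = 1 then (Fintype.card F : ℂ) - 1 else 0 := by
  have hu : ∀ j : ℕ, (ω ^ j) a = (ω a) ^ j := fun j => by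
    simpa using MulChar.pow_apply_coe ω j (Units.mk0 a ha)
  simp_rw [hu]
  split_ifs with h
  · subst h
    simp [Nat.cast_sub Fintype.card_pos]
  · have h1 : ω a ≠ 1 := by
      obtain ⟨χ, hχ⟩ := MulChar.exists_apply_ne_one_of_hasEnoughRootsOfUnity F ℂ h
      obtain ⟨j, rfl⟩ := hω χ
      intro h0
      apply hχ
      rw [hu, h0, one_pow]
    have h2 := mul_neg_geom_sum (ω a) (Fintype.card F - 1)
    rw [← map_pow, FiniteField.pow_card_sub_one_eq_one a ha, map_one, sub_self] at h2
    rcases mul_eq_zero.mp h2 with h3 | h3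
    · exact absurd (sub_eq_zero.mp h3).symm h1
    · exact h3

lemma order_gen (ω : MulChar F ℂ) (hω : ∀ χ : MulChar F ℂ, ∃ j : ℕ, χ = ω ^ j) :
    orderOf ω = Fintype.card F - 1 := by
  rw [orderOf_eq_card_of_forall_mem_zpowers]
  · rw [MulChar.card_eq_card_units_of_hasEnoughRootsOfUnity, Nat.card_eq_fintype_card,
      Fintype.card_units]
  · intro χ
    obtain ⟨j, rfl⟩ := hω χ
    exact ⟨j, by simp⟩

/-- a nontrivial quadratic character is the quadratic character -/
lemma quad_eq (hF : ringChar F ≠ 2) (φ : MulChar F ℂ) (h2 : φ ^ 2 = 1) (h1 : φ ≠ 1) (v : F) :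
    φ v = ((quadraticChar F v : ℤ) : ℂ) := by
  have hsq : ∀ u : F, u ≠ 0 → φ (u ^ 2) = 1 := by
    intro u hu
    rw [map_pow, ← MulChar.pow_apply' φ two_ne_zero, h2]
    exact MulChar.one_apply (isUnit_iff_ne_zero.mpr hu)
  have hpm : ∀ u : F, u ≠ 0 → φ u = 1 ∨ φ u = -1 := by
    intro u hu
    have := hsq u hu
    rw [map_pow] at this
    rcases mul_eq_zero.mp (show (φ u - 1) * (φ u + 1) = 0 by linear_combination this) with h | h
    · left; linear_combination h
    · right; linear_combination h
  by_cases hv : v = 0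
  · subst hv; simp [MulChar.map_zero]
  by_cases hs : IsSquare v
  · obtain ⟨u, rfl⟩ := hs
    have hu : u ≠ 0 := fun h => hv (by simp [h])
    rw [← pow_two, hsq u hu, quadraticChar_sq_one' hu]
    simp
  · obtain ⟨w, hw⟩ := MulChar.ne_one_iff.mp h1
    have hw0 : (w : F) ≠ 0 := w.ne_zero
    have hws : ¬ IsSquare (w : F) := by
      rintro ⟨u, hu⟩
      apply hw
      rw [hu, ← pow_two]
      exact hsq u (fun h => hw0 (by rw [hu, h]; simp))
    have hqv := quadraticChar_neg_one_iff_not_isSquare.mpr hs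
    have hqw := quadraticChar_neg_one_iff_not_isSquare.mpr hws
    have hvw : IsSquare (v * w) := by
      rw [← quadraticChar_one_iff_isSquare (mul_ne_zero hv hw0), map_mul, hqv, hqw]; norm_num
    obtain ⟨u, hu⟩ := hvw
    have h3 : φ (v * w) = 1 := by
      rw [hu, ← pow_two]
      exact hsq u (fun h => (mul_ne_zero hv hw0) (by rw [hu, h]; simp))
    rw [map_mul, (hpm w hw0).resolve_left hw] at h3
    rw [hqv]
    push_cast
    linear_combination -h3

lemma sum_sq (hF : ringChar F ≠ 2) (φ : MulChar F ℂ) (h2 : φ ^ 2 = 1) (h1 : φ ≠ 1) (f : F → ℂ) :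
    ∑ u, f (u ^ 2) = ∑ v, (1 + φ v) * f v := by
  rw [← Finset.sum_fiberwise (g := fun u : F => u ^ 2)]
  apply Finset.sum_congr rfl
  intro v _
  have : ∑ i ∈ Finset.univ.filter (fun u : F => u ^ 2 = v), f (i ^ 2) =
      ∑ i ∈ Finset.univ.filter (fun u : F => u ^ 2 = v), f v := by
    apply Finset.sum_congr rfl
    intro u hu
    rw [(Finset.mem_filter.mp hu).2]
  rw [this, Finset.sum_const, nsmul_eq_mul]
  congr 1
  have h3 := quadraticChar_card_sqrts hF v
  rw [quad_eq hF φ h2 h1]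
  have h4 : (Finset.univ.filter (fun u : F => u ^ 2 = v)) = {x : F | x ^ 2 = v}.toFinset := by
    ext; simp
  rw [h4]
  have h5 := congrArg (Int.cast : ℤ → ℂ) h3
  push_cast at h5
  rw [add_comm, ← h5]

lemma jac2 (A B : MulChar F ℂ) : jacobiS F ![A, B] = ∑ x, A x * B (1 - x) := by
  unfold jacobiS
  symm
  refine Finset.sum_bij' (fun x _ => ![x, 1 - x]) (fun v _ => v 0) ?_ ?_ ?_ ?_ ?_
  · intro x _; simp
  · intro v _; simp
  · intro x _; simp
  · intro v hv
    have : v 0 + v 1 = 1 := by simpa using hv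
    ext i; fin_cases i
    · simp
    · simp [← this]
  · intro x _; simp

lemma g_jac2 {ψ : AddChar F ℂ} (A B : MulChar F ℂ) (h : A * B ≠ 1) :
    gaussSum A ψ * gaussSum B ψ = gaussSum (A * B) ψ * jacobiS F ![A, B] := by
  have := prod_gauss_of_ne ![A, B] ψ (by simpa using h)
  simpa using this

/-- duplication formula -/
lemma dup {ψ : AddChar F ℂ} (hψ : ψ.IsPrimitive) (hF : ringChar F ≠ 2)
    (φ : MulChar F ℂ) (h2 : φ ^ 2 = 1) (h1 : φ ≠ 1) (χ : MulChar F ℂ) :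
    gaussSum χ ψ * gaussSum (χ * φ) ψ * χ 4 = gaussSum (χ ^ 2) ψ * gaussSum φ ψ := by
  have h20 : (2 : F) ≠ 0 := Ring.two_ne_zero hF
  have h40 : (4 : F) ≠ 0 := by
    rw [show (4 : F) = 2 ^ 2 by norm_num]; exact pow_ne_zero _ h20
  have h4 : ∀ χ : MulChar F ℂ, χ ^ 2 = 1 → χ 4 = 1 := by
    intro χ h
    rw [show (4 : F) = 2 ^ 2 by norm_num, map_pow, ← MulChar.pow_apply' χ two_ne_zero, h]
    exact MulChar.one_apply (isUnit_iff_ne_zero.mpr h20)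
  by_cases hc : χ = 1
  · subst hc
    rw [h4 1 (one_pow 2)]
    simp
  by_cases hcp : χ * φ = 1
  · have : χ = φ := by
      rw [mul_eq_one_iff_eq_inv.mp hcp]
      symm
      rw [← mul_eq_one_iff_eq_inv, ← pow_two, h2]
    subst this
    rw [h4 _ h2, hcp, h2]; ring
  by_cases hc2 : χ ^ 2 = 1
  · exfalso
    apply hcp
    ext a
    have ha : (a : F) ≠ 0 := a.ne_zero
    rw [MulChar.mul_apply, quad_eq hF χ hc2 hc, quad_eq hF φ h2 h1]
    rcases quadraticChar_dichotomy ha with h | h <;> simp [h]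
  have e1 : jacobiS F ![χ, χ] * χ 4 = jacobiS F ![φ, χ] := by
    rw [jac2, jac2, Finset.sum_mul]
    have : ∀ x : F, χ x * χ (1 - x) * χ 4 = χ (1 - (1 - 2 * x) ^ 2) := by
      intro x
      rw [← map_mul, ← map_mul]; congr 1; ring
    simp_rw [this]
    have e2 : ∑ x, χ (1 - (1 - 2 * x) ^ 2) = ∑ u, χ (1 - u ^ 2) := by
      apply Fintype.sum_bijective (fun x : F => 1 - 2 * x)
      · apply Function.Injective.bijective_of_finite
        intro x y h
        apply mul_left_cancel₀ h20
        have h : 1 - 2 * x = 1 - 2 * y := h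
        linear_combination -h
      · intro x; rfl
    rw [e2, sum_sq hF φ h2 h1 (fun v => χ (1 - v))]
    simp_rw [add_mul, one_mul, Finset.sum_add_distrib]
    have e3 : ∑ x, χ (1 - x) = ∑ x, χ x := by
      apply Fintype.sum_bijective (fun x : F => 1 - x)
      · exact (Equiv.subLeft (1 : F)).bijective
      · intro x; rfl
    rw [e3, MulChar.sum_eq_zero_of_ne_one hc, zero_add]
  have a1 := g_jac2 (ψ := ψ) χ χ (by rwa [← pow_two])
  have a2 := g_jac2 (ψ := ψ) φ χ (by rwa [mul_comm])
  rw [← pow_two χ] at a1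
  rw [mul_comm φ χ] at a2
  apply mul_left_cancel₀ (g_ne hψ χ)
  rw [← e1] at a2
  linear_combination gaussSum (χ * φ) ψ * χ 4 * a1 - gaussSum (χ ^ 2) ψ * a2

end HD2

section HD3
variable {F : Type} [Field F] [Fintype F]

lemma card_rset (ζ : F) (hζ : ζ ^ 2 + ζ + 1 = 0) (h3 : (3 : F) ≠ 0) :
    ((Finset.univ.filter (fun r : F => r ≠ 0 ∧ r + 1 ≠ 0 ∧ r ^ 2 + r + 1 ≠ 0)).card : ℂ) =
      (Fintype.card F : ℂ) - 4 := by
  have hz0 : ζ ≠ 0 := by rintro rfl; simp at hζ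
  have hz1 : ζ ≠ -1 := by rintro rfl; norm_num at hζ
  have hw0 : -1 - ζ ≠ 0 := fun h => hz1 (by linear_combination -h)
  have hw1 : -1 - ζ ≠ -1 := fun h => hz0 (by linear_combination -h)
  have hzw : ζ ≠ -1 - ζ := by
    intro h
    apply h3
    linear_combination 4 * hζ - (2 * ζ + 1) * h
  have hc : Finset.univ.filter (fun r : F => r ≠ 0 ∧ r + 1 ≠ 0 ∧ r ^ 2 + r + 1 ≠ 0) =
      ({0, -1, ζ, -1 - ζ} : Finset F)ᶜ := by
    ext r
    simp only [Finset.mem_filter, Finset.mem_univ, true_and, Finset.mem_compl, Finset.mem_insert,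
      Finset.mem_singleton, not_or]
    have hf : r ^ 2 + r + 1 = (r - ζ) * (r - (-1 - ζ)) := by linear_combination hζ
    rw [hf, mul_ne_zero_iff, sub_ne_zero, sub_ne_zero, ← sub_neg_eq_add r 1, sub_ne_zero]
  have h4 : ({0, -1, ζ, -1 - ζ} : Finset F).card = 4 := by
    rw [Finset.card_insert_of_notMem, Finset.card_insert_of_notMem, Finset.card_insert_of_notMem,
      Finset.card_singleton]
    · simpa using hzw
    · simp only [Finset.mem_insert, Finset.mem_singleton, not_or]
      exact ⟨hz1.symm, hw1.symm⟩
    · simp only [Finset.mem_insert, Finset.mem_singleton, not_or]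
      exact ⟨by simp, hz0.symm, hw0.symm⟩
  rw [hc, Finset.card_compl, h4, Nat.cast_sub]
  · norm_num
  · rw [← h4]; exact Finset.card_le_univ _

/-- the character sum over the nodal cubic -/
lemma nodal (ζ : F) (hζ : ζ ^ 2 + ζ + 1 = 0) (h3 : (3 : F) ≠ 0) (ρ : MulChar F ℂ) (hρ : ρ ^ 3 = 1) :
    ∑ v ∈ Finset.univ.filter (fun v : Fin 3 → F => v 0 + v 1 + v 2 = 1 ∧ 27 * (v 0 * v 1 * v 2) = 1),
      ρ (v 1) * ρ (v 2) ^ 2 = (Fintype.card F : ℂ) - 3 := by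
  have hcube : ∀ x : F, x ≠ 0 → ρ x ^ 3 = 1 := by
    intro x hx
    rw [← MulChar.pow_apply' ρ three_ne_zero, hρ]
    exact MulChar.one_apply (isUnit_iff_ne_zero.mpr hx)
  have h3i : (3 : F)⁻¹ ≠ 0 := inv_ne_zero h3
  set A := Finset.univ.filter
    (fun v : Fin 3 → F => v 0 + v 1 + v 2 = 1 ∧ 27 * (v 0 * v 1 * v 2) = 1) with hA
  have hnode : (fun _ => (3 : F)⁻¹ : Fin 3 → F) ∈ A := by
    rw [hA, Finset.mem_filter]
    refine ⟨Finset.mem_univ _, ?_, ?_⟩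
    · field_simp; norm_num
    · field_simp; norm_num
  rw [← Finset.add_sum_erase A _ hnode]
  have hn1 : ρ ((3 : F)⁻¹) * ρ ((3 : F)⁻¹) ^ 2 = 1 := by
    rw [← hcube _ h3i]; ring
  rw [hn1]
  have key : ∑ v ∈ A.erase (fun _ => (3 : F)⁻¹), ρ (v 1) * ρ (v 2) ^ 2 =
      ∑ r ∈ Finset.univ.filter (fun r : F => r ≠ 0 ∧ r + 1 ≠ 0 ∧ r ^ 2 + r + 1 ≠ 0), (1 : ℂ) := by
    have facts : ∀ v ∈ A.erase (fun _ => (3 : F)⁻¹),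
        3 * v 1 - 1 ≠ 0 ∧ 3 * v 2 - 1 ≠ 0 ∧ (3 * v 1 - 1) + (3 * v 2 - 1) ≠ 0 ∧
        (3 * v 1 - 1) ^ 2 + (3 * v 1 - 1) * (3 * v 2 - 1) + (3 * v 2 - 1) ^ 2 =
          - (3 * v 1 - 1) * (3 * v 2 - 1) * ((3 * v 1 - 1) + (3 * v 2 - 1)) ∧
        v 0 = 1 - v 1 - v 2 := by
      intro v hv
      rw [Finset.mem_erase, hA, Finset.mem_filter] at hv
      obtain ⟨hne, -, hs, hp⟩ := hv
      have h0 : v 0 = 1 - v 1 - v 2 := by linear_combination hs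
      rw [h0] at hp
      have hq : (3 * v 1 - 1) ^ 2 + (3 * v 1 - 1) * (3 * v 2 - 1) + (3 * v 2 - 1) ^ 2 =
          - (3 * v 1 - 1) * (3 * v 2 - 1) * ((3 * v 1 - 1) + (3 * v 2 - 1)) := by
        linear_combination -hp
      have fin : 3 * v 1 - 1 = 0 → 3 * v 2 - 1 = 0 → False := by
        intro e1 e2
        apply hne
        have f1 : v 1 = 3⁻¹ := by field_simp; linear_combination e1
        have f2 : v 2 = 3⁻¹ := by field_simp; linear_combination e2
        have f0 : v 0 = 3⁻¹ := by
          rw [h0]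
          field_simp; linear_combination - e1 - e2
        ext i; fin_cases i
        · exact f0
        · exact f1
        · exact f2
      refine ⟨?_, ?_, ?_, hq, h0⟩
      · intro e1
        rw [e1] at hq
        exact fin e1 (pow_eq_zero_iff two_ne_zero |>.mp (by linear_combination hq))
      · intro e1
        rw [e1] at hq
        exact fin (pow_eq_zero_iff two_ne_zero |>.mp (by linear_combination hq)) e1
      · intro e1
        have e2 : 3 * v 2 - 1 = -(3 * v 1 - 1) := by linear_combination e1
        have e3 : 3 * v 1 - 1 = 0 := pow_eq_zero_iff two_ne_zero |>.mp (by
          rw [e2] at hq; linear_combination hq)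
        exact fin e3 (by rw [e2, e3, neg_zero])
    refine Finset.sum_bij' (fun v _ => (3 * v 1 - 1) / (3 * v 2 - 1))
      (fun r _ => ![(1 + r) ^ 2 / (3 * r), - r ^ 2 / (3 * (r + 1)), -1 / (3 * (r * (r + 1)))])
      ?_ ?_ ?_ ?_ ?_
    · intro v hv
      obtain ⟨hy, hz, hyz, hq, h0⟩ := facts v hv
      generalize 3 * v 1 - 1 = y at *
      generalize 3 * v 2 - 1 = z at *
      simp only [Finset.mem_filter, Finset.mem_univ, true_and]
      refine ⟨div_ne_zero hy hz, ?_, ?_⟩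
      · have : y / z + 1 = (y + z) / z := by field_simp
        rw [this]; exact div_ne_zero hyz hz
      · have : (y / z) ^ 2 + y / z + 1 = (y ^ 2 + y * z + z ^ 2) / z ^ 2 := by field_simp
        rw [this, hq]
        exact div_ne_zero (mul_ne_zero (mul_ne_zero (neg_ne_zero.mpr hy) hz) hyz) (pow_ne_zero _ hz)
    · intro r hr
      simp only [Finset.mem_filter, Finset.mem_univ, true_and] at hr
      obtain ⟨r0, r1, r2⟩ := hr
      rw [Finset.mem_erase, hA, Finset.mem_filter]
      refine ⟨?_, Finset.mem_univ _, ?_, ?_⟩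
      · intro h
        have h1 := congrFun h 1
        simp at h1
        field_simp at h1
        apply r2
        linear_combination -h1
      · simp
        field_simp
        ring
      · simp
        field_simp
        ring
    · intro v hv
      obtain ⟨hy, hz, hyz, hq, h0⟩ := facts v hv
      have e1 : v 1 = ((3 * v 1 - 1) + 1) / 3 := by field_simp; ring
      have e2 : v 2 = ((3 * v 2 - 1) + 1) / 3 := by field_simp; ring
      have e0 : v 0 = (1 - (3 * v 1 - 1) - (3 * v 2 - 1)) / 3 := by
        rw [h0]; field_simp; ring
      generalize 3 * v 1 - 1 = y at *
      generalize 3 * v 2 - 1 = z at *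
      have hyz' : y / z + 1 ≠ 0 := by
        have : y / z + 1 = (y + z) / z := by field_simp
        rw [this]; exact div_ne_zero hyz hz
      ext i; fin_cases i
      · simp only [Fin.zero_eta, Matrix.cons_val_zero]
        rw [e0]
        field_simp
        linear_combination hq
      · simp only [Fin.mk_one, Matrix.cons_val_one, Matrix.cons_val_zero]
        rw [e1]
        field_simp
        linear_combination -hq
      · simp only [Fin.reduceFinMk, Matrix.cons_val]
        rw [e2]
        field_simp
        linear_combination -hq
    · intro r hr
      simp only [Finset.mem_filter, Finset.mem_univ, true_and] at hr
      obtain ⟨r0, r1, r2⟩ := hr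
      simp only [Matrix.cons_val]
      have e1 : 3 * (-r ^ 2 / (3 * (r + 1))) - 1 = -(r ^ 2 + r + 1) / (r + 1) := by
        field_simp; ring
      have e2 : 3 * (-1 / (3 * (r * (r + 1)))) - 1 = -(r ^ 2 + r + 1) / (r * (r + 1)) := by
        field_simp; ring
      rw [e1, e2]
      have r3 : -(r ^ 2 + r + 1) ≠ 0 := neg_ne_zero.mpr r2
      generalize -(r ^ 2 + r + 1) = c at *
      field_simp
    · intro v hv
      obtain ⟨hy, hz, hyz, hq, h0⟩ := facts v hv
      have hm := hv
      rw [Finset.mem_erase, hA, Finset.mem_filter] at hm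
      have hp := hm.2.2.2
      have v2 : v 2 ≠ 0 := by
        intro h; rw [h] at hp; simp at hp
      have e : v 1 = ((3 * v 1 - 1) / (3 * v 2 - 1)) ^ 3 * v 2 := by
        rw [div_pow]
        field_simp
        linear_combination (v 2 - v 1) * hq
      have hr : (3 * v 1 - 1) / (3 * v 2 - 1) ≠ 0 := div_ne_zero hy hz
      generalize (3 * v 1 - 1) / (3 * v 2 - 1) = r at *
      rw [e, map_mul, map_pow, hcube r hr, one_mul]
      rw [← hcube _ v2]; ring
  rw [key, Finset.sum_const, nsmul_eq_mul, mul_one, card_rset ζ hζ h3]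
  ring

end HD3

section HD4
variable {F : Type} [Field F] [Fintype F]

lemma three_ne (s : ℕ) (hs : Fintype.card F - 1 = 3 * s) : (3 : F) ≠ 0 := by
  intro h
  have h1 : ((Fintype.card F : ℕ) : F) = 0 := FiniteField.cast_card_eq_zero F
  have h2 : Fintype.card F = 3 * s + 1 := by
    have := Fintype.card_pos (α := F); omega
  rw [h2] at h1
  push_cast at h1
  rw [h] at h1
  simp at h1

lemma exists_zeta (s : ℕ) (hs : Fintype.card F - 1 = 3 * s) : ∃ ζ : F, ζ ^ 2 + ζ + 1 = 0 := by
  haveI : Fact (Nat.Prime 3) := ⟨Nat.prime_three⟩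
  obtain ⟨u, hu⟩ := exists_prime_orderOf_dvd_card (G := Fˣ) 3 (by rw [Fintype.card_units, hs]; simp)
  refine ⟨u, ?_⟩
  have h3 : u ^ 3 = 1 := by rw [← hu]; exact pow_orderOf_eq_one u
  have h1 : u ≠ 1 := by rintro rfl; simp at hu
  have h3' : (u : F) ^ 3 = 1 := by rw [← Units.val_pow_eq_pow_val, h3, Units.val_one]
  have h1' : (u : F) - 1 ≠ 0 := sub_ne_zero.mpr (by simpa using h1)
  apply mul_left_cancel₀ h1'
  linear_combination h3'

/-- triplication formula -/
lemma trip {ψ : AddChar F ℂ} (hψ : ψ.IsPrimitive) (s : ℕ) (hs : Fintype.card F - 1 = 3 * s)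
    (ω : MulChar F ℂ) (hω : ∀ χ : MulChar F ℂ, ∃ j : ℕ, χ = ω ^ j) (χ : MulChar F ℂ) :
    gaussSum χ ψ * gaussSum (χ * ω ^ s) ψ * gaussSum (χ * ω ^ (2 * s)) ψ * χ 27 =
      (Fintype.card F : ℂ) * gaussSum (χ ^ 3) ψ := by
  have hcard : Fintype.card F = 3 * s + 1 := by
    have := Fintype.card_pos (α := F); omega
  have hs0 : 0 < s := by
    have := Fintype.one_lt_card (α := F); omega
  have hord := order_gen ω hω
  rw [hs] at hord
  have hpow : ∀ n : ℕ, ω ^ n = 1 ↔ 3 * s ∣ n := fun n => by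
    rw [← hord, orderOf_dvd_iff_pow_eq_one]
  have h3 := three_ne s hs
  have h27 : (27 : F) ≠ 0 := by
    rw [show (27 : F) = 3 ^ 3 by norm_num]; exact pow_ne_zero _ h3
  obtain ⟨ζ, hζ⟩ := exists_zeta s hs
  have hper : ω ^ (3 * s) = 1 := (hpow _).mpr dvd_rfl
  have hρ1 : ω ^ s ≠ 1 := by
    rw [Ne, hpow]; intro h; have := Nat.le_of_dvd hs0 h; omega
  have hρ3 : (ω ^ s) ^ 3 = 1 := by rw [← pow_mul, mul_comm s 3, hper]
  have hinv : ω ^ (2 * s) = (ω ^ s)⁻¹ := by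
    rw [eq_inv_iff_mul_eq_one, ← pow_add, show 2 * s + s = 3 * s by ring, hper]
  have hρm : (ω ^ s) (-1) = 1 := by
    have : (ω ^ s) (-1) = ((ω ^ s) ^ 3) (-1) := by
      rw [MulChar.pow_apply' _ three_ne_zero, ← map_pow]; congr 1; norm_num
    rw [this, hρ3]
    exact MulChar.one_apply (isUnit_iff_ne_zero.mpr (by simp))
  have hgg : gaussSum (ω ^ s) ψ * gaussSum (ω ^ (2 * s)) ψ = (Fintype.card F : ℂ) := by
    rw [hinv, g_inv hψ hρ1, hρm, one_mul]
  set P : MulChar F ℂ → ℂ := fun χ =>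
    gaussSum χ ψ * gaussSum (χ * ω ^ s) ψ * gaussSum (χ * ω ^ (2 * s)) ψ with hP
  set J : MulChar F ℂ → ℂ := fun χ => jacobiS F ![χ, χ * ω ^ s, χ * ω ^ (2 * s)] with hJ
  set h : MulChar F ℂ → ℂ := fun χ => P χ * χ 27 / gaussSum (χ ^ 3) ψ with hh
  have hprod : ∀ χ : MulChar F ℂ, ∏ i, (![χ, χ * ω ^ s, χ * ω ^ (2 * s)] : Fin 3 → _) i = χ ^ 3 := by
    intro χ
    rw [Fin.prod_univ_three]
    simp only [Matrix.cons_val]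
    rw [hinv]
    calc χ * (χ * ω ^ s) * (χ * (ω ^ s)⁻¹) = χ ^ 3 * (ω ^ s * (ω ^ s)⁻¹) := by
          simp only [pow_succ, pow_zero, one_mul]; ac_rfl
      _ = χ ^ 3 := by simp
  have hA : ∀ χ : MulChar F ℂ, χ ^ 3 ≠ 1 → P χ = gaussSum (χ ^ 3) ψ * J χ := by
    intro χ hχ
    have := prod_gauss_of_ne ![χ, χ * ω ^ s, χ * ω ^ (2 * s)] ψ (by rwa [hprod])
    rw [hprod, Fin.prod_univ_three] at this
    exact this
  have h27c : ∀ χ : MulChar F ℂ, χ ^ 3 = 1 → χ 27 = 1 := by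
    intro χ hχ
    rw [show (27 : F) = 3 ^ 3 by norm_num, map_pow, ← MulChar.pow_apply' χ three_ne_zero, hχ]
    exact MulChar.one_apply (isUnit_iff_ne_zero.mpr h3)
  have hB0 : ∀ χ : MulChar F ℂ, χ ^ 3 = 1 → P χ = -(Fintype.card F : ℂ) := by
    intro χ hχ
    obtain ⟨j, rfl⟩ := hω χ
    rw [← pow_mul, hpow] at hχ
    obtain ⟨m, hm⟩ := hχ
    have hj : j = s * m := by
      have : j * 3 = (s * m) * 3 := by rw [hm]; ring
      omega
    have g1 := g_one hψ
    simp only [hP]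
    have hmod : ω ^ (s * m) = ω ^ (s * (m % 3)) := by
      conv_lhs => rw [← Nat.div_add_mod m 3]
      rw [mul_add, pow_add, show s * (3 * (m / 3)) = 3 * s * (m / 3) by ring, pow_mul, hper]
      simp
    rw [hj, hmod]
    have : m % 3 < 3 := Nat.mod_lt _ (by norm_num)
    have e21 : ω ^ (s * 2) * ω ^ s = 1 := by
      rw [← pow_add, show s * 2 + s = 3 * s by ring, hper]
    have e12 : ω ^ s * ω ^ (2 * s) = 1 := by
      rw [← pow_add, show s + 2 * s = 3 * s by ring, hper]
    have e11 : ω ^ s * ω ^ s = ω ^ (2 * s) := by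
      rw [← pow_add]; congr 1; ring
    have e22 : ω ^ (s * 2) * ω ^ (2 * s) = ω ^ s := by
      rw [← pow_add, show s * 2 + 2 * s = 3 * s + s by ring, pow_add, hper, one_mul]
    interval_cases m % 3
    · simp only [mul_zero, pow_zero, one_mul, g1]
      linear_combination -hgg
    · rw [mul_one, e11, e12, g1]
      linear_combination -hgg
    · rw [e21, e22, g1, mul_comm s 2]
      linear_combination -hgg
  have hB : ∀ χ : MulChar F ℂ, χ ^ 3 = 1 → J χ = 1 := by
    intro χ hχ
    have h2 := hB0 χ hχ
    have hex : ∃ i0, (![χ, χ * ω ^ s, χ * ω ^ (2 * s)] : Fin 3 → MulChar F ℂ) i0 ≠ 1 := by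
      by_cases hc : χ = 1
      · refine ⟨1, ?_⟩
        subst hc
        simpa using hρ1
      · exact ⟨0, by simpa using hc⟩
    obtain ⟨i0, hi0⟩ := hex
    have := prod_gauss_of_eq ![χ, χ * ω ^ s, χ * ω ^ (2 * s)] ψ (prim_ne_one hψ) (by rwa [hprod]) i0 hi0
    rw [Fin.prod_univ_three] at this
    change P χ = _ * J χ at this
    rw [h2] at this
    have hq := cardC_ne_zero (F := F)
    apply mul_left_cancel₀ (neg_ne_zero.mpr hq)
    rw [← this]; ring
  have hval : ∀ χ : MulChar F ℂ,
      h χ = χ 27 * J χ + if χ ^ 3 = 1 then (Fintype.card F : ℂ) - 1 else 0 := by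
    intro χ
    simp only [hh]
    split_ifs with hc
    · rw [hB0 χ hc, hB χ hc, h27c χ hc, hc, g_one hψ]; ring
    · rw [hA χ hc]
      have := g_ne hψ (χ ^ 3)
      field_simp
      ring
  have hnorm : ∀ χ : MulChar F ℂ, ‖h χ‖ = (Fintype.card F : ℝ) := by
    intro χ
    by_cases hc : χ ^ 3 = 1
    · simp only [hh]
      rw [hB0 χ hc, h27c χ hc, hc, g_one hψ]; simp
    · have c1 : χ ≠ 1 := by rintro rfl; simp at hc
      have c2 : χ * ω ^ s ≠ 1 := by
        intro h0; apply hc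
        have := congrArg (· ^ 3) h0
        simpa [mul_pow, hρ3] using this
      have c3 : χ * ω ^ (2 * s) ≠ 1 := by
        intro h0; apply hc
        have := congrArg (· ^ 3) h0
        simpa [hinv, mul_pow, hρ3] using this
      simp only [hh, hP]
      rw [norm_div, norm_mul, norm_mul, norm_mul, g_norm hψ c1, g_norm hψ c2, g_norm hψ c3,
        g_norm hψ hc, mc_norm χ h27]
      have hpos : (0 : ℝ) < Fintype.card F := by exact_mod_cast Fintype.card_pos
      have hsq := Real.mul_self_sqrt hpos.le
      have hne := (Real.sqrt_pos.mpr hpos).ne'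
      field_simp
      linear_combination hsq
  -- the sum of all `h`
  have hsumJ : ∑ j ∈ Finset.range (Fintype.card F - 1), (ω ^ j) 27 * J (ω ^ j) =
      ((Fintype.card F : ℂ) - 1) * ((Fintype.card F : ℂ) - 3) := by
    rw [← nodal ζ hζ h3 (ω ^ s) hρ3]
    have e1 : ∀ j, (ω ^ j) 27 * J (ω ^ j) =
        ∑ v ∈ Finset.univ.filter (fun v : Fin 3 → F => v 0 + v 1 + v 2 = 1),
          ((ω ^ s) (v 1) * (ω ^ s) (v 2) ^ 2) * (ω ^ j) (27 * (v 0 * v 1 * v 2)) := by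
      intro j
      simp only [hJ, jacobiS, Fin.sum_univ_three, Fin.prod_univ_three, Matrix.cons_val]
      rw [Finset.mul_sum]
      apply Finset.sum_congr rfl
      intro v _
      rw [mul_comm 2 s, pow_mul]
      simp only [MulChar.mul_apply, map_mul]
      rw [MulChar.pow_apply' _ two_ne_zero]
      ring
    simp_rw [e1]
    rw [Finset.sum_comm, Finset.mul_sum, ← Finset.filter_filter, Finset.sum_filter (p := fun v : Fin 3 → F => 27 * (v 0 * v 1 * v 2) = 1)]
    apply Finset.sum_congr rfl
    intro v _
    rw [← Finset.mul_sum]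
    by_cases hz : v 0 * v 1 * v 2 = 0
    · rw [hz]
      simp [MulChar.map_zero]
    · rw [orth ω hω _ (mul_ne_zero h27 hz)]
      split_ifs <;> ring
  have hsum3 : ∑ j ∈ Finset.range (Fintype.card F - 1),
      (if (ω ^ j) ^ 3 = 1 then (Fintype.card F : ℂ) - 1 else 0) =
        3 * ((Fintype.card F : ℂ) - 1) := by
    rw [← Finset.sum_filter]
    have : (Finset.range (Fintype.card F - 1)).filter (fun j => (ω ^ j) ^ 3 = 1) =
        {0, s, 2 * s} := by
      ext j
      simp only [Finset.mem_filter, Finset.mem_range, Finset.mem_insert, Finset.mem_singleton]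
      rw [hs, ← pow_mul, hpow]
      constructor
      · rintro ⟨h1, m, hm⟩
        have hj : j = s * m := by
          have : j * 3 = (s * m) * 3 := by rw [hm]; ring
          omega
        have hm3 : m < 3 := by
          rw [hj, mul_comm 3 s] at h1
          exact lt_of_mul_lt_mul_left h1 (Nat.zero_le _)
        interval_cases m <;> omega
      · rintro (rfl | rfl | rfl)
        · exact ⟨by omega, by simp⟩
        · exact ⟨by omega, ⟨1, by ring⟩⟩
        · exact ⟨by omega, ⟨2, by ring⟩⟩
    rw [this, Finset.sum_const, nsmul_eq_mul]
    congr 1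
    rw [Finset.card_insert_of_notMem, Finset.card_insert_of_notMem, Finset.card_singleton]
    · norm_num
    · simp; omega
    · simp; omega
  have hsum : ∑ j ∈ Finset.range (Fintype.card F - 1), h (ω ^ j) =
      ((Fintype.card F : ℂ) - 1) * (Fintype.card F : ℂ) := by
    simp_rw [hval]
    rw [Finset.sum_add_distrib, hsumJ, hsum3]
    ring
  have hre : ∀ j ∈ Finset.range (Fintype.card F - 1), (h (ω ^ j)).re = (Fintype.card F : ℝ) := by
    rw [← Finset.sum_eq_sum_iff_of_le]
    · rw [← Complex.re_sum, hsum, Finset.sum_const, Finset.card_range, nsmul_eq_mul,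
        Nat.cast_sub Fintype.card_pos]
      have : ((Fintype.card F : ℂ) - 1) * (Fintype.card F : ℂ) =
        ((((Fintype.card F : ℝ) - 1) * (Fintype.card F : ℝ) : ℝ) : ℂ) := by push_cast; ring
      rw [this, Complex.ofReal_re]; norm_num
    · intro j _
      rw [← hnorm (ω ^ j)]
      exact Complex.re_le_norm _
  have hall : h χ = (Fintype.card F : ℂ) := by
    obtain ⟨j, rfl⟩ := hω χ
    have hj : ω ^ j = ω ^ (j % (Fintype.card F - 1)) := by
      rw [hs, ← hord, pow_mod_orderOf]
    rw [hj]
    have hr := hre (j % (Fintype.card F - 1))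
      (Finset.mem_range.mpr (Nat.mod_lt _ (by omega)))
    have hn := hnorm (ω ^ (j % (Fintype.card F - 1)))
    generalize h (ω ^ (j % (Fintype.card F - 1))) = z at *
    have h0 := Complex.sq_norm z
    rw [hn, Complex.normSq_apply, hr] at h0
    have him : z.im = 0 := by
      have : z.im * z.im = 0 := by linear_combination -h0
      simpa using this
    apply Complex.ext
    · rw [hr]; simp
    · rw [him]; simp
  have hg := g_ne hψ (χ ^ 3)
  simp only [hh, hP] at hall
  rw [div_eq_iff hg] at hall
  exact hall

end HD4

section HD5
variable {F : Type} [Field F] [Fintype F]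

lemma ringChar_ne_two_of (t : ℕ) (ht : Fintype.card F - 1 = 6 * t) : ringChar F ≠ 2 := by
  intro h
  have h1 : ((Fintype.card F : ℕ) : F) = 0 := FiniteField.cast_card_eq_zero F
  have h2 : Fintype.card F = 6 * t + 1 := by
    have := Fintype.card_pos (α := F); omega
  have h3 : (2 : F) = 0 := by
    have := ringChar.Nat.cast_ringChar (R := F)
    rw [h] at this
    exact_mod_cast this
  rw [h2] at h1
  push_cast at h1
  rw [show (6 : F) = 2 * 3 by norm_num, h3] at h1
  simp at h1

lemma mc_sq_one {φ : MulChar F ℂ} (h2 : φ ^ 2 = 1) {x : F} (hx : x ≠ 0) : φ (x ^ 2) = 1 := by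
  rw [map_pow, ← MulChar.pow_apply' φ two_ne_zero, h2]
  exact MulChar.one_apply (isUnit_iff_ne_zero.mpr hx)

lemma hd6 {ψ : AddChar F ℂ} (hψ : ψ.IsPrimitive) (t : ℕ) (ht : Fintype.card F - 1 = 6 * t)
    (ω : MulChar F ℂ) (hω : ∀ χ : MulChar F ℂ, ∃ j : ℕ, χ = ω ^ j)
    (α : MulChar F ℂ) (hα : α = ω ^ t) (h6 : α ^ 6 = 1) (h3 : α ^ 3 ≠ 1) (χ : MulChar F ℂ) :
    gaussSum χ ψ * gaussSum (χ * α) ψ * gaussSum (χ * α ^ 2) ψ * gaussSum (χ * α ^ 3) ψ *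
      gaussSum (χ * α ^ 4) ψ * gaussSum (χ * α ^ 5) ψ * χ 46656 =
      α (-1) * (Fintype.card F : ℂ) ^ 2 * gaussSum (χ ^ 6) ψ * gaussSum (α ^ 3) ψ := by
  have hF := ringChar_ne_two_of t ht
  have h30 : (3 : F) ≠ 0 := three_ne (2 * t) (by omega)
  obtain ⟨ζ, hζ⟩ := exists_zeta (F := F) (2 * t) (by omega)
  have hq2 : (α ^ 3) ^ 2 = 1 := by rw [← pow_mul]; exact h6
  have t1 := trip hψ (2 * t) (by omega) ω hω χ
  have t2 := trip hψ (2 * t) (by omega) ω hω (χ * α ^ 3)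
  have d := dup hψ hF (α ^ 3) hq2 h3 (χ ^ 3)
  rw [show ω ^ (2 * t) = α ^ 2 by rw [hα, ← pow_mul, mul_comm],
    show ω ^ (2 * (2 * t)) = α ^ 4 by rw [hα, ← pow_mul]; congr 1; ring] at t1 t2
  rw [show χ * α ^ 3 * α ^ 2 = χ * α ^ 5 by rw [mul_assoc, ← pow_add],
    show χ * α ^ 3 * α ^ 4 = χ * α by
      rw [mul_assoc, ← pow_add, show 3 + 4 = 6 + 1 by norm_num, pow_add, h6, one_mul, pow_one],
    show (χ * α ^ 3) ^ 3 = χ ^ 3 * α ^ 3 by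
      rw [mul_pow, ← pow_mul, show 3 * 3 = 6 + 3 by norm_num, pow_add α 6, h6, one_mul],
    MulChar.mul_apply] at t2
  rw [← pow_mul, show 3 * 2 = 6 by norm_num, MulChar.pow_apply' χ three_ne_zero] at d
  have hα1 : (α ^ 3) (-1) = α (-1) := by
    rw [MulChar.pow_apply' α three_ne_zero, ← map_pow]; congr 1; norm_num
  have h27 : (α ^ 3) 27 = α (-1) := by
    have e : (27 : F) = (-1) * (3 * (2 * ζ + 1)) ^ 2 := by linear_combination 36 * hζ
    have hne : 3 * (2 * ζ + 1) ≠ 0 := by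
      intro h
      have h27 : (27 : F) = 0 := by rw [e, h]; simp
      rw [show (27 : F) = 3 ^ 3 by norm_num] at h27
      exact h30 (pow_eq_zero_iff three_ne_zero |>.mp h27)
    rw [e, map_mul, mc_sq_one hq2 hne, hα1, mul_one]
  rw [h27] at t2
  have hX : χ 46656 = χ 27 ^ 2 * χ 4 ^ 3 := by
    rw [← map_pow, ← map_pow, ← map_mul]; congr 1; norm_num
  have hε := mc_neg_one_sq α
  rw [hX]
  have t12 := congrArg₂ (· * ·) t1 t2
  linear_combination χ 4 ^ 3 * α (-1) * t12 + (Fintype.card F : ℂ) ^ 2 * α (-1) * d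
    - (gaussSum χ ψ * gaussSum (χ * α) ψ * gaussSum (χ * α ^ 2) ψ * gaussSum (χ * α ^ 3) ψ *
      gaussSum (χ * α ^ 4) ψ * gaussSum (χ * α ^ 5) ψ * (χ 27 ^ 2 * χ 4 ^ 3)) * hε

lemma gBinom_eq {ψ : AddChar F ℂ} (hψ : ψ.IsPrimitive) (A B C : MulChar F ℂ) (h : A * B⁻¹ = C)
    (hC : C ≠ 1) :
    gBinom F A B = B (-1) / (Fintype.card F : ℂ) * (gaussSum A ψ * gaussSum B⁻¹ ψ / gaussSum C ψ) := by
  unfold gBinom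
  rw [g_jac2 A B⁻¹ (by rwa [h]), h, mul_div_cancel_left₀ _ (g_ne hψ C)]

lemma g_pair {ψ : AddChar F ℂ} (hψ : ψ.IsPrimitive) (x : MulChar F ℂ) :
    gaussSum x ψ * gaussSum x⁻¹ ψ = x (-1) * (if x = 1 then 1 else (Fintype.card F : ℂ)) := by
  split_ifs with h
  · subst h
    rw [inv_one, g_one hψ, MulChar.one_apply (by simp)]; norm_num
  · exact g_inv hψ h

/-- the exceptional characters -/
noncomputable def excS (α : MulChar F ℂ) : Finset (MulChar F ℂ) := {α, α ^ 2, α ^ 4, α ^ 5}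

lemma exc_prod (α : MulChar F ℂ) (h6 : α ^ 6 = 1) (h1 : α ≠ 1) (h2 : α ^ 2 ≠ 1) (h3 : α ^ 3 ≠ 1)
    (χ : MulChar F ℂ) (q : ℂ) :
    (if χ * α = 1 then 1 else q) * (if χ * α ^ 2 = 1 then 1 else q) *
      (if χ * α ^ 4 = 1 then 1 else q) * (if χ * α ^ 5 = 1 then 1 else q) =
      if χ ∈ excS α then q ^ 3 else q ^ 4 := by
  have h4 : α ^ 4 ≠ 1 := by
    intro h; apply h2
    calc α ^ 2 = α ^ 2 * α ^ 4 := by rw [h, mul_one]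
      _ = 1 := by rw [← pow_add, h6]
  have h5 : α ^ 5 ≠ 1 := by
    intro h; apply h1
    calc α = α ^ 1 * α ^ 5 := by rw [h, mul_one, pow_one]
      _ = 1 := by rw [← pow_add, h6]
  have p7 : α ^ 7 = α := by rw [show 7 = 6 + 1 by norm_num, pow_add, h6, one_mul, pow_one]
  have p8 : α ^ 8 = α ^ 2 := by rw [show 8 = 6 + 2 by norm_num, pow_add, h6, one_mul]
  have p9 : α ^ 9 = α ^ 3 := by rw [show 9 = 6 + 3 by norm_num, pow_add, h6, one_mul]
  have p10 : α ^ 10 = α ^ 4 := by rw [show 10 = 6 + 4 by norm_num, pow_add, h6, one_mul]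
  have m1 : ∀ n : ℕ, α * α ^ n = α ^ (n + 1) := fun n => by rw [pow_succ, mul_comm]
  by_cases hS : χ ∈ excS α
  · rw [if_pos hS]
    unfold excS at hS
    simp only [Finset.mem_insert, Finset.mem_singleton] at hS
    rcases hS with rfl | rfl | rfl | rfl
    · rw [← pow_two, m1, m1, m1, if_neg h2, if_neg h3, if_neg h5, if_pos h6]; ring
    · rw [← pow_succ, ← pow_add, ← pow_add, ← pow_add]
      norm_num only
      rw [p7, if_neg h3, if_neg h4, if_pos h6, if_neg h1]; ring
    · rw [← pow_succ, ← pow_add, ← pow_add, ← pow_add]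
      norm_num only
      rw [p8, p9, if_neg h5, if_pos h6, if_neg h2, if_neg h3]; ring
    · rw [← pow_succ, ← pow_add, ← pow_add, ← pow_add]
      norm_num only
      rw [p7, p9, p10, if_pos h6, if_neg h1, if_neg h3, if_neg h4]; ring
  · rw [if_neg hS]
    unfold excS at hS
    simp only [Finset.mem_insert, Finset.mem_singleton, not_or] at hS
    obtain ⟨s1, s2, s4, s5⟩ := hS
    have key : ∀ a b : ℕ, a + b = 6 → χ * α ^ a = 1 → χ = α ^ b := by
      intro a b hab h
      calc χ = χ * α ^ (a + b) := by rw [hab, h6, mul_one]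
        _ = α ^ b := by rw [pow_add, ← mul_assoc, h, one_mul]
    rw [if_neg (fun h => s5 (key 1 5 (by norm_num) (by rwa [pow_one]))),
      if_neg (fun h => s4 (key 2 4 (by norm_num) h)),
      if_neg (fun h => s2 (key 4 2 (by norm_num) h)),
      if_neg (fun h => s1 (by have := key 5 1 (by norm_num) h; rwa [pow_one] at this))]
    ring

set_option maxHeartbeats 2000000 in
/-- the per-character identity -/
lemma core {ψ : AddChar F ℂ} (hψ : ψ.IsPrimitive) (t : ℕ) (ht : Fintype.card F - 1 = 6 * t)
    (ω : MulChar F ℂ) (hω : ∀ χ : MulChar F ℂ, ∃ j : ℕ, χ = ω ^ j)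
    (α : MulChar F ℂ) (hα : α = ω ^ t) (h6 : α ^ 6 = 1) (h1 : α ≠ 1) (h2 : α ^ 2 ≠ 1)
    (h3 : α ^ 3 ≠ 1) (lam : F) (hlam : lam ≠ 0) (χ : MulChar F ℂ) :
    gaussSum χ ψ ^ 4 * gaussSum (χ * α ^ 3) ψ ^ 2 / gaussSum (χ ^ 6) ψ * (χ ^ 6) (6 * lam) +
      (if χ ∈ excS α then ((Fintype.card F : ℂ) - 1) / (Fintype.card F : ℂ) *
        (gaussSum χ ψ ^ 4 * gaussSum (χ * α ^ 3) ψ ^ 2) else 0) =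
      -((Fintype.card F : ℂ) ^ 3) * α (-1) * jacobiS F ![α ^ 3, (α ^ 2)⁻¹, α⁻¹] *
        ((Fintype.card F : ℂ) *
          (gBinom F (α * χ⁻¹) χ⁻¹ * (gBinom F (α⁻¹ * χ⁻¹) (1 * χ⁻¹) *
            gBinom F ((α ^ 2)⁻¹ * χ⁻¹) (1 * χ⁻¹) * gBinom F (α ^ 2 * χ⁻¹) (α ^ 3 * χ⁻¹)) *
            χ⁻¹ (lam ^ 6)⁻¹)) := by
  have H := hd6 hψ t ht ω hω α hα h6 h3 χ
  have hq := cardC_ne_zero (F := F)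
  have i5 : α⁻¹ = α ^ 5 := by
    rw [inv_eq_iff_mul_eq_one, ← pow_succ', h6]
  have i4 : (α ^ 2)⁻¹ = α ^ 4 := by
    rw [inv_eq_iff_mul_eq_one, ← pow_add, h6]
  have i3 : (α ^ 3)⁻¹ = α ^ 3 := by
    rw [inv_eq_iff_mul_eq_one, ← pow_add, h6]
  -- the Jacobi sum
  have hJ := prod_gauss_of_eq ![α ^ 3, (α ^ 2)⁻¹, α⁻¹] ψ (prim_ne_one hψ)
    (by
      rw [Fin.prod_univ_three]
      simp only [Matrix.cons_val]
      rw [i5, i4, ← pow_add, ← pow_add, show 3 + 4 + 5 = 6 * 2 by norm_num, pow_mul, h6, one_pow])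
    0 (by simpa using h3)
  rw [Fin.prod_univ_three] at hJ
  simp only [Matrix.cons_val] at hJ
  -- the binomials
  have hb1 := gBinom_eq hψ (α * χ⁻¹) χ⁻¹ α (by simp) h1
  have hb2 := gBinom_eq hψ (α⁻¹ * χ⁻¹) (1 * χ⁻¹) α⁻¹ (by simp) (by simpa using h1)
  have hb3 := gBinom_eq hψ ((α ^ 2)⁻¹ * χ⁻¹) (1 * χ⁻¹) (α ^ 2)⁻¹ (by simp) (by simpa using h2)
  have hb4 := gBinom_eq hψ (α ^ 2 * χ⁻¹) (α ^ 3 * χ⁻¹) α⁻¹ (by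
      rw [mul_inv_rev, inv_inv, i3, i5]
      calc α ^ 2 * χ⁻¹ * (χ * α ^ 3) = α ^ 2 * (χ⁻¹ * χ) * α ^ 3 := by simp only [mul_assoc]
        _ = α ^ 5 := by rw [inv_mul_cancel, mul_one, ← pow_add]) (by simpa using h1)
  rw [hb1, hb2, hb3, hb4]
  -- rewriting the inverse characters
  have c5 : α * χ⁻¹ = (χ * α ^ 5)⁻¹ := by rw [← i5, mul_inv_rev, inv_inv]
  have c1 : α⁻¹ * χ⁻¹ = (χ * α)⁻¹ := by rw [mul_inv_rev]
  have c2 : (α ^ 2)⁻¹ * χ⁻¹ = (χ * α ^ 2)⁻¹ := by rw [mul_inv_rev]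
  have c4 : α ^ 2 * χ⁻¹ = (χ * α ^ 4)⁻¹ := by rw [← i4, mul_inv_rev, inv_inv]
  have c3 : (α ^ 3 * χ⁻¹)⁻¹ = χ * α ^ 3 := by rw [mul_inv_rev, inv_inv, i3]
  rw [c3, c1, c2, c4, c5, one_mul, inv_inv, MulChar.mul_apply, mc_neg_one_inv]
  have hα1 : (α ^ 3) (-1) = α (-1) := by
    rw [MulChar.pow_apply' α three_ne_zero, ← map_pow]; congr 1; norm_num
  rw [hα1]
  -- the values at lambda
  have hL : χ⁻¹ (lam ^ 6)⁻¹ = χ (lam ^ 6) := by rw [MulChar.inv_apply', inv_inv]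
  have hXL : (χ ^ 6) (6 * lam) = χ 46656 * χ (lam ^ 6) := by
    rw [MulChar.pow_apply' χ (by norm_num), ← map_pow, ← map_mul]; congr 1; ring
  rw [hL, hXL]
  -- the pairs
  have P1 := g_pair hψ (χ * α)
  have P2 := g_pair hψ (χ * α ^ 2)
  have P4 := g_pair hψ (χ * α ^ 4)
  have P5 := g_pair hψ (χ * α ^ 5)
  have E := exc_prod α h6 h1 h2 h3 χ (Fintype.card F : ℂ)
  have PP : (gaussSum (χ * α) ψ * gaussSum (χ * α ^ 2) ψ * gaussSum (χ * α ^ 4) ψ *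
      gaussSum (χ * α ^ 5) ψ) * (gaussSum (χ * α)⁻¹ ψ * gaussSum (χ * α ^ 2)⁻¹ ψ *
      gaussSum (χ * α ^ 4)⁻¹ ψ * gaussSum (χ * α ^ 5)⁻¹ ψ) =
      if χ ∈ excS α then (Fintype.card F : ℂ) ^ 3 else (Fintype.card F : ℂ) ^ 4 := by
    rw [← E]
    have sg : (χ * α) (-1) * (χ * α ^ 2) (-1) * (χ * α ^ 4) (-1) * (χ * α ^ 5) (-1) = 1 := by
      have s1 := mc_neg_one_sq α
      have s2 := mc_neg_one_sq χ
      simp only [MulChar.mul_apply]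
      rw [MulChar.pow_apply' α (n := 2) (by norm_num), MulChar.pow_apply' α (n := 4) (by norm_num),
        MulChar.pow_apply' α (n := 5) (by norm_num)]
      calc _ = (χ (-1) * χ (-1)) ^ 2 * (α (-1) * α (-1)) ^ 6 := by ring
        _ = 1 := by rw [s1, s2]; norm_num
    calc _ = (gaussSum (χ * α) ψ * gaussSum (χ * α)⁻¹ ψ) *
          (gaussSum (χ * α ^ 2) ψ * gaussSum (χ * α ^ 2)⁻¹ ψ) *
          (gaussSum (χ * α ^ 4) ψ * gaussSum (χ * α ^ 4)⁻¹ ψ) *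
          (gaussSum (χ * α ^ 5) ψ * gaussSum (χ * α ^ 5)⁻¹ ψ) := by ring
      _ = _ := by
        rw [P1, P2, P4, P5]
        linear_combination ((if χ * α = 1 then 1 else (Fintype.card F : ℂ)) *
          (if χ * α ^ 2 = 1 then 1 else (Fintype.card F : ℂ)) *
          (if χ * α ^ 4 = 1 then 1 else (Fintype.card F : ℂ)) *
          (if χ * α ^ 5 = 1 then 1 else (Fintype.card F : ℂ))) * sg
  have hε := mc_neg_one_sq α
  have hε' := mc_neg_one_sq χ
  have uv := g_inv hψ h1
  have n1 := g_ne hψ α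
  have n2 := g_ne hψ α⁻¹
  have n3 := g_ne hψ (α ^ 2)⁻¹
  have n6 := g_ne hψ (χ ^ 6)
  have nP : gaussSum (χ * α) ψ * gaussSum (χ * α ^ 2) ψ * gaussSum (χ * α ^ 4) ψ *
      gaussSum (χ * α ^ 5) ψ ≠ 0 :=
    mul_ne_zero (mul_ne_zero (mul_ne_zero (g_ne hψ _) (g_ne hψ _)) (g_ne hψ _)) (g_ne hψ _)
  have hexc : χ ∈ excS α → χ ^ 6 = 1 := by
    intro hS
    have hp : ∀ n : ℕ, (α ^ n) ^ 6 = 1 := fun n => by rw [← pow_mul, mul_comm, pow_mul, h6, one_pow]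
    unfold excS at hS
    simp only [Finset.mem_insert, Finset.mem_singleton] at hS
    rcases hS with rfl | rfl | rfl | rfl
    · exact h6
    · exact hp _
    · exact hp _
    · exact hp _
  have h60 : (6 : F) ≠ 0 := by
    rw [show (6 : F) = 2 * 3 by norm_num]
    exact mul_ne_zero (Ring.two_ne_zero (ringChar_ne_two_of t ht)) (three_ne (2 * t) (by omega))
  have hXL1 : χ ^ 6 = 1 → χ 46656 = 1 ∧ χ (lam ^ 6) = 1 := by
    intro h
    have : ∀ a : F, a ≠ 0 → χ (a ^ 6) = 1 := by
      intro a ha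
      rw [map_pow, ← MulChar.pow_apply' χ (by norm_num), h]
      exact MulChar.one_apply (isUnit_iff_ne_zero.mpr ha)
    refine ⟨?_, this _ hlam⟩
    rw [show (46656 : F) = 6 ^ 6 by norm_num]
    exact this _ h60
  have g1 := g_one hψ
  -- simplification of the right-hand side
  have hJ' : jacobiS F ![α ^ 3, (α ^ 2)⁻¹, α⁻¹] =
      -(gaussSum (α ^ 3) ψ * gaussSum (α ^ 2)⁻¹ ψ * gaussSum α⁻¹ ψ) / (Fintype.card F : ℂ) := by
    rw [hJ]; field_simp
  rw [hJ']
  set a0 := gaussSum χ ψ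
  set a1 := gaussSum (χ * α) ψ
  set a2 := gaussSum (χ * α ^ 2) ψ
  set a3 := gaussSum (χ * α ^ 3) ψ
  set a4 := gaussSum (χ * α ^ 4) ψ
  set a5 := gaussSum (χ * α ^ 5) ψ
  set b1 := gaussSum (χ * α)⁻¹ ψ
  set b2 := gaussSum (χ * α ^ 2)⁻¹ ψ
  set b4 := gaussSum (χ * α ^ 4)⁻¹ ψ
  set b5 := gaussSum (χ * α ^ 5)⁻¹ ψ
  set q : ℂ := (Fintype.card F : ℂ)
  set u := gaussSum α ψ
  set v := gaussSum α⁻¹ ψ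
  set w := gaussSum (α ^ 2)⁻¹ ψ
  set g3 := gaussSum (α ^ 3) ψ
  set g6 := gaussSum (χ ^ 6) ψ
  set X := χ 46656
  set L := χ (lam ^ 6)
  set ε := α (-1)
  set δ := χ (-1)
  have hR : -q ^ 3 * ε * (-(g3 * w * v) / q) *
      (q * (δ / q * (b5 * a0 / u) * (δ / q * (b1 * a0 / v) * (δ / q * (b2 * a0 / w)) *
        (ε * δ / q * (b4 * a3 / v))) * L)) = ε * g3 * (b1 * b2 * b4 * b5) * a0 ^ 3 * a3 * L / q ^ 2 := by
    have e1 : -q ^ 3 * ε * (-(g3 * w * v) / q) *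
      (q * (δ / q * (b5 * a0 / u) * (δ / q * (b1 * a0 / v) * (δ / q * (b2 * a0 / w)) *
        (ε * δ / q * (b4 * a3 / v))) * L)) =
        (ε * ε) * (δ * δ) ^ 2 * g3 * (b1 * b2 * b4 * b5) * a0 ^ 3 * a3 * L / (q * (u * v)) := by
      field_simp
    rw [e1, hε, hε', uv]
    have hε0 : ε ≠ 0 := left_ne_zero_of_mul_eq_one hε
    rw [div_eq_div_iff (mul_ne_zero hq (mul_ne_zero hε0 hq)) (pow_ne_zero 2 hq)]
    linear_combination (-(g3 * (b1 * b2 * b4 * b5) * a0 ^ 3 * a3 * L) * q ^ 2) * hε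
  rw [hR]
  by_cases hS : χ ∈ excS α
  · rw [if_pos hS] at PP ⊢
    have hg6 : g6 = -1 := by
      change gaussSum (χ ^ 6) ψ = -1
      rw [hexc hS, g1]
    obtain ⟨hX, hL1⟩ := hXL1 (hexc hS)
    rw [hX, hg6] at H
    rw [hX, hL1, hg6]
    have : ε * g3 * (b1 * b2 * b4 * b5) = - a0 * a3 * q := by
      apply mul_left_cancel₀ nP
      apply mul_left_cancel₀ (pow_ne_zero 2 hq)
      linear_combination ε * g3 * q ^ 2 * PP + q ^ 3 * H
    rw [this]
    field_simp
    ring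
  · rw [if_neg hS] at PP ⊢
    have : ε * g3 * (b1 * b2 * b4 * b5) * g6 = a0 * a3 * X * q ^ 2 := by
      apply mul_left_cancel₀ nP
      linear_combination ε * g3 * g6 * PP - q ^ 2 * H
    rw [add_zero]
    field_simp
    linear_combination -(a0 ^ 3 * a3 * L) * this

end HD5

section HD6
variable {F : Type} [Field F] [Fintype F]

/-- the standard additive character -/
noncomputable def stdPsi (p : ℕ) [Fact p.Prime] (F : Type) [Field F] [Fintype F]
    [Algebra (ZMod p) F] : AddChar F ℂ :=
  (ZMod.stdAddChar (N := p)).compAddMonoidHom (Algebra.trace (ZMod p) F).toAddMonoidHom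

lemma gaussChar_eq (p : ℕ) [Fact p.Prime] [Algebra (ZMod p) F] (χ : MulChar F ℂ) :
    gaussChar p F χ = gaussSum χ (stdPsi p F) := by
  unfold gaussChar gaussSum stdPsi
  apply Finset.sum_congr rfl
  intro x _
  congr 1
  have h := ZMod.stdAddChar_coe (N := p) ((Algebra.trace (ZMod p) F x).val : ℤ)
  simp only [Int.cast_natCast, ZMod.natCast_zmod_val] at h
  exact h.symm

lemma stdPsi_prim (p : ℕ) [Fact p.Prime] [Algebra (ZMod p) F] : (stdPsi p F).IsPrimitive := by
  apply AddChar.IsPrimitive.of_ne_one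
  rw [AddChar.ne_one_iff]
  obtain ⟨a, ha⟩ := Algebra.trace_surjective (ZMod p) F 1
  refine ⟨a, fun h => ?_⟩
  have h' : ZMod.stdAddChar (Algebra.trace (ZMod p) F a) = 1 := h
  rw [ha, ← AddChar.map_zero_eq_one (ZMod.stdAddChar (N := p))] at h'
  exact one_ne_zero (ZMod.injective_stdAddChar h')

lemma reindex [Fintype (MulChar F ℂ)] (ω : MulChar F ℂ)
    (hω : ∀ χ : MulChar F ℂ, ∃ j : ℕ, χ = ω ^ j) (f : MulChar F ℂ → ℂ) :
    ∑ j ∈ Finset.range (Fintype.card F - 1), f (ω ^ j) = ∑ χ, f χ := by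
  have ho := order_gen ω hω
  have hpos : 0 < Fintype.card F - 1 := by
    have := Fintype.one_lt_card (α := F); omega
  refine Finset.sum_nbij (fun j => ω ^ j) (fun _ _ => Finset.mem_univ _) ?_ ?_ (fun _ _ => rfl)
  · intro a ha b hb hab
    simp only [Finset.coe_range, Set.mem_Iio] at ha hb
    exact pow_injOn_Iio_orderOf (by simpa [ho] using ha) (by simpa [ho] using hb) hab
  · intro χ _
    obtain ⟨j, rfl⟩ := hω χ
    refine ⟨j % (Fintype.card F - 1), ?_, ?_⟩
    · simpa using Nat.mod_lt _ hpos
    · change ω ^ (j % (Fintype.card F - 1)) = ω ^ j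
      rw [← ho, pow_mod_orderOf]

lemma exc_sum [Fintype (MulChar F ℂ)] (α : MulChar F ℂ) (h1 : α ≠ 1) (h2 : α ^ 2 ≠ 1)
    (h3 : α ^ 3 ≠ 1) (h4 : α ^ 4 ≠ 1) (E : MulChar F ℂ → ℂ) :
    (∑ χ, if χ ∈ excS α then E χ else 0) = E α + (E (α ^ 2) + (E (α ^ 4) + E (α ^ 5))) := by
  have key : ∀ a b : ℕ, α ^ b ≠ 1 → α ^ a ≠ α ^ (a + b) := by
    intro a b h hh
    rw [pow_add] at hh
    exact h (mul_eq_left.mp hh.symm)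
  have k12 := key 1 1 (by rwa [pow_one])
  have k14 := key 1 3 h3
  have k15 := key 1 4 h4
  have k24 := key 2 2 h2
  have k25 := key 2 3 h3
  have k45 := key 4 1 (by rwa [pow_one])
  norm_num only at k12 k14 k15 k24 k25 k45
  rw [← Finset.sum_filter, Finset.filter_mem_eq_inter, Finset.univ_inter]
  unfold excS
  rw [Finset.sum_insert, Finset.sum_insert, Finset.sum_insert, Finset.sum_singleton]
  · simpa using k45
  · simpa using ⟨k24, k25⟩
  · simp only [Finset.mem_insert, Finset.mem_singleton, not_or]
    rw [pow_one] at k12 k14 k15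
    exact ⟨k12, k14, k15⟩

lemma nqw_zero (p : ℕ) [Fact p.Prime] [Algebra (ZMod p) F] (ω : MulChar F ℂ)
    (w : Fin 6 → ZMod 6) (h : ∃ i, w i = 0) (h' : ∃ i, w i ≠ 0) : NqW p F ω 6 w = 0 := by
  unfold NqW
  rw [if_neg (by push Not; exact h'), if_neg (by push Not; exact h)]

lemma nqw_ne (p : ℕ) [Fact p.Prime] [Algebra (ZMod p) F] (ω : MulChar F ℂ) (t : ℕ)
    (ht : Fintype.card F - 1 = 6 * t) (a b : ZMod 6) (w : Fin 6 → ZMod 6)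
    (hw : w = ![a, a, a, a, b, b]) (ha : a ≠ 0) (hb : b ≠ 0) :
    NqW p F ω 6 w = 1 / (Fintype.card F : ℂ) *
      (gaussSum ((ω ^ t) ^ a.val) (stdPsi p F) ^ 4 *
        gaussSum ((ω ^ t) ^ b.val) (stdPsi p F) ^ 2) := by
  subst hw
  unfold NqW
  have ht' : (Fintype.card F - 1) / 6 = t := by omega
  rw [if_neg (fun h => ha (h 0)), if_pos (by intro i; fin_cases i <;> simpa), ht']
  congr 1
  rw [Fin.prod_univ_six]
  simp only [gaussChar_eq, Matrix.cons_val]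
  rw [← pow_mul, ← pow_mul, mul_comm t, mul_comm t]
  ring

end HD6

/-- The contribution of the class of `w = (0,0,0,0,3,3)` in Koblitz's formula. -/
theorem class_000033 (p e q t : ℕ) [Fact p.Prime] (F : Type) [Field F] [Fintype F]
    [Algebra (ZMod p) F]
    (he : 0 < e) (hq : q = Fintype.card F) (hqe : q = p ^ e) (hmod : q % 6 = 1)
    (ht : t = (q - 1) / 6)
    (ω : MulChar F ℂ) (hω : ∀ χ : MulChar F ℂ, ∃ j : ℕ, χ = ω ^ j)
    (ω₆ ω₃ ω₂ : MulChar F ℂ)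
    (hω₆ : ω₆ = ω ^ t) (hω₃ : ω₃ = ω ^ (2 * t)) (hω₂ : ω₂ = ω ^ (3 * t))
    (lam : F) (hlam : lam ≠ 0) (hlam6 : lam ^ 6 ≠ 1) :
    (∑ k ∈ Finset.range 6, NqW p F ω 6 (fun i => (![0,0,0,0,3,3] : Fin 6 → ZMod 6) i + (k : ZMod 6))) +
      SW p F ω 6 (fun _ => 1) (![0,0,0,0,3,3] : Fin 6 → ZMod 6) lam =
      -((q : ℂ) ^ 3) * ω₆ (-1) * jacobiS F ![ω₂, ω₃⁻¹, ω₆⁻¹] *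
        greeneF F ω ![ω₆, ω₆⁻¹, ω₃⁻¹, ω₃] ![1, 1, ω₂] (lam ^ 6)⁻¹ := by
  have hcard : Fintype.card F - 1 = 6 * t := by omega
  have h1c := Fintype.one_lt_card (α := F)
  have htpos : 0 < t := by omega
  have hord := order_gen ω hω
  have hne : ∀ k : ℕ, 0 < k → k < 6 → (ω ^ t) ^ k ≠ 1 := by
    intro k hk hk6 h
    rw [← pow_mul] at h
    have hd := orderOf_dvd_of_pow_eq_one h
    rw [hord, hcard] at hd
    have := Nat.le_of_dvd (by positivity) hd
    nlinarith
  have h6 : (ω ^ t) ^ 6 = 1 := by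
    rw [← pow_mul, mul_comm, ← hcard, ← hord, pow_orderOf_eq_one]
  obtain ⟨α, hα⟩ : ∃ α, α = ω ^ t := ⟨_, rfl⟩
  have e3 : ω₃ = α ^ 2 := by rw [hω₃, hα, ← pow_mul, mul_comm]
  have e2 : ω₂ = α ^ 3 := by rw [hω₂, hα, ← pow_mul, mul_comm]
  have e6 : ω₆ = α := by rw [hω₆, hα]
  rw [e2, e3, e6, hq]
  have hψ := stdPsi_prim (F := F) p
  let _ : Fintype (MulChar F ℂ) := Fintype.ofFinite _
  have hq0 := cardC_ne_zero (F := F)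
  have hq1 : (Fintype.card F : ℂ) - 1 ≠ 0 := by
    rw [sub_ne_zero]
    exact_mod_cast h1c.ne'
  rw [← hα] at hne h6
  have hn1 : α ≠ 1 := by simpa using hne 1 (by norm_num) (by norm_num)
  -- the diagonal part
  have hN : (∑ k ∈ Finset.range 6, NqW p F ω 6
      (fun i => (![0,0,0,0,3,3] : Fin 6 → ZMod 6) i + (k : ZMod 6))) =
      ((Fintype.card F : ℂ) - 1)⁻¹ * ∑ χ, if χ ∈ excS α then
        ((Fintype.card F : ℂ) - 1) / (Fintype.card F : ℂ) *
        (gaussSum χ (stdPsi p F) ^ 4 * gaussSum (χ * α ^ 3) (stdPsi p F) ^ 2) else 0 := by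
    rw [exc_sum α hn1 (hne 2 (by norm_num) (by norm_num)) (hne 3 (by norm_num) (by norm_num))
      (hne 4 (by norm_num) (by norm_num))]
    have n1 := nqw_ne p ω t hcard 1 4
      (fun i => (![0,0,0,0,3,3] : Fin 6 → ZMod 6) i + ((1 : ℕ) : ZMod 6)) (by decide)
      (by decide) (by decide)
    have n2 := nqw_ne p ω t hcard 2 5
      (fun i => (![0,0,0,0,3,3] : Fin 6 → ZMod 6) i + ((2 : ℕ) : ZMod 6)) (by decide)
      (by decide) (by decide)
    have n4 := nqw_ne p ω t hcard 4 1
      (fun i => (![0,0,0,0,3,3] : Fin 6 → ZMod 6) i + ((4 : ℕ) : ZMod 6)) (by decide)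
      (by decide) (by decide)
    have n5 := nqw_ne p ω t hcard 5 2
      (fun i => (![0,0,0,0,3,3] : Fin 6 → ZMod 6) i + ((5 : ℕ) : ZMod 6)) (by decide)
      (by decide) (by decide)
    have n0 := nqw_zero p ω
      (fun i => (![0,0,0,0,3,3] : Fin 6 → ZMod 6) i + ((0 : ℕ) : ZMod 6))
      ⟨0, by decide⟩ ⟨4, by decide⟩
    have n3 := nqw_zero p ω
      (fun i => (![0,0,0,0,3,3] : Fin 6 → ZMod 6) i + ((3 : ℕ) : ZMod 6))
      ⟨4, by decide⟩ ⟨0, by decide⟩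
    have v1 : ZMod.val (1 : ZMod 6) = 1 := by decide
    have v2 : ZMod.val (2 : ZMod 6) = 2 := by decide
    have v4 : ZMod.val (4 : ZMod 6) = 4 := by decide
    have v5 : ZMod.val (5 : ZMod 6) = 5 := by decide
    rw [← hα, v1, v4, pow_one] at n1 n4
    rw [← hα, v2, v5] at n2 n5
    have r1 : α * α ^ 3 = α ^ 4 := by rw [← pow_succ']
    have r2 : α ^ 2 * α ^ 3 = α ^ 5 := by rw [← pow_add]
    have r4 : α ^ 4 * α ^ 3 = α := by
      rw [← pow_add, show 4 + 3 = 6 + 1 by norm_num, pow_add, h6, one_mul, pow_one]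
    have r5 : α ^ 5 * α ^ 3 = α ^ 2 := by
      rw [← pow_add, show 5 + 3 = 6 + 2 by norm_num, pow_add, h6, one_mul]
    rw [Finset.sum_range_succ, Finset.sum_range_succ, Finset.sum_range_succ,
      Finset.sum_range_succ, Finset.sum_range_succ, Finset.sum_range_one,
      n0, n1, n2, n3, n4, n5, r1, r2, r4, r5]
    field_simp
    ring
  -- the hypergeometric part
  have hS : SW p F ω 6 (fun _ => 1) (![0,0,0,0,3,3] : Fin 6 → ZMod 6) lam =
      ((Fintype.card F : ℂ) - 1)⁻¹ * ∑ χ : MulChar F ℂ, gaussSum χ (stdPsi p F) ^ 4 *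
        gaussSum (χ * α ^ 3) (stdPsi p F) ^ 2 / gaussSum (χ ^ 6) (stdPsi p F) *
        (χ ^ 6) (6 * lam) := by
    rw [← reindex ω hω]
    unfold SW
    congr 1
    apply Finset.sum_congr rfl
    intro j _
    have ht' : (Fintype.card F - 1) / 6 = t := by omega
    have v0 : ZMod.val (0 : ZMod 6) = 0 := by decide
    have v3 : ZMod.val (3 : ZMod 6) = 3 := by decide
    rw [Fin.prod_univ_six]
    simp only [gaussChar_eq, Matrix.cons_val, v0, v3, ht']
    have r0 : ω ^ (0 * t + 1 * j) = ω ^ j := by congr 1; ring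
    have r3 : ω ^ (3 * t + 1 * j) = ω ^ j * α ^ 3 := by
      rw [hα, ← pow_mul, ← pow_add]; congr 1; ring
    have r6 : ω ^ (6 * j) = (ω ^ j) ^ 6 := by rw [← pow_mul, mul_comm]
    rw [r0, r3, r6]
    push_cast
    ring
  have hG : greeneF F ω ![α, α⁻¹, (α ^ 2)⁻¹, α ^ 2] ![1, 1, α ^ 3] (lam ^ 6)⁻¹ =
      ((Fintype.card F : ℂ) - 1)⁻¹ * ∑ χ : MulChar F ℂ, ((Fintype.card F : ℂ) *
          (gBinom F (α * χ⁻¹) χ⁻¹ * (gBinom F (α⁻¹ * χ⁻¹) (1 * χ⁻¹) *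
            gBinom F ((α ^ 2)⁻¹ * χ⁻¹) (1 * χ⁻¹) * gBinom F (α ^ 2 * χ⁻¹) (α ^ 3 * χ⁻¹)) *
            χ⁻¹ (lam ^ 6)⁻¹)) := by
    have hc := Equiv.sum_comp (Equiv.inv (MulChar F ℂ)) (fun χ => (Fintype.card F : ℂ) *
          (gBinom F (α * χ) χ * (gBinom F (α⁻¹ * χ) (1 * χ) *
            gBinom F ((α ^ 2)⁻¹ * χ) (1 * χ) * gBinom F (α ^ 2 * χ) (α ^ 3 * χ)) *
            χ (lam ^ 6)⁻¹))
    simp only [Equiv.inv_apply] at hc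
    rw [hc, ← Finset.mul_sum, ← reindex ω hω, ← mul_assoc]
    unfold greeneF
    congr 1
    · rw [div_eq_mul_inv, mul_comm]
    · apply Finset.sum_congr rfl
      intro j _
      rw [Fin.prod_univ_three]
      rfl
  rw [hN, hS, hG, ← mul_add, mul_left_comm, ← Finset.sum_add_distrib, Finset.mul_sum _ _ (_ * _)]
  congr 1
  apply Finset.sum_congr rfl
  intro χ _
  rw [add_comm]
  exact core hψ t hcard ω hω α hα h6 hn1 (hne 2 (by norm_num) (by norm_num))
    (hne 3 (by norm_num) (by norm_num)) lam hlam χ
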